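/- arXiv:1502.03704 — 2 statements merged into one kernel-verified Lean document; each statement's English description precedes it below -/
import Mathlib

section
/- Let B be a set of n positive integers. Then the length of the longest arithmetic progression contained in the product set B·B = {b·b' : b, b' ∈ B} is at most C·n·log n for some absolute constant C (for n sufficiently large). -/
open scoped Pointwise

lemma key_rank (K : ℕ) (X w : Finset (ℕ → ℚ))
    (hX : ∀ x ∈ X, x ∈ Submodule.span ℚ (w : Set (ℕ → ℚ))) (P : Finset ℕ)
    (h1 : ∀ p ∈ P, ∃ x ∈ X, x p ≠ 0)
    (h2 : ∀ x ∈ X, (P.filter (fun p => x p ≠ 0)).card ≤ K) : P.card ≤ K * w.card := by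
  classical
  obtain ⟨b, hbX, hspan, hli⟩ := exists_linearIndependent ℚ (X : Set (ℕ → ℚ))
  have hbfin : b.Finite := X.finite_toSet.subset hbX
  obtain ⟨S, rfl⟩ := hbfin.exists_finset_coe
  have hSw : S.card ≤ w.card := by
    have := linearIndependent_le_span' (R := ℚ) _ hli (w : Set (ℕ → ℚ)) (by
      rintro _ ⟨x, rfl⟩
      exact hX _ (hbX x.2))
    simpa using this
  have hP : P ⊆ S.biUnion (fun x => P.filter (fun p => x p ≠ 0)) := by
    intro p hp
    by_contra hcon
    simp only [Finset.mem_biUnion, Finset.mem_filter, not_exists, not_and, not_not] at hcon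
    obtain ⟨x, hx, hxp⟩ := h1 p hp
    have hle : Submodule.span ℚ (S : Set (ℕ → ℚ)) ≤ LinearMap.ker (LinearMap.proj (R := ℚ) (φ := fun _ : ℕ => ℚ) p) := by
      rw [Submodule.span_le]
      intro y hy
      simpa using hcon y hy hp
    have : x ∈ Submodule.span ℚ (S : Set (ℕ → ℚ)) := by
      rw [hspan]; exact Submodule.subset_span hx
    exact hxp (by simpa using hle this)
  calc P.card ≤ _ := Finset.card_le_card hP
    _ ≤ S.card * K := Finset.card_biUnion_le_card_mul _ _ _ (fun x hx => h2 x (hbX hx))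
    _ ≤ K * w.card := by rw [mul_comm]; gcongr

lemma combine (B : Finset ℕ) (hB : ∀ b ∈ B, 0 < b) (g N K : ℕ) (m : ℕ → ℕ) (hg : 0 < g)
    (hm : ∀ i < N, 0 < m i) (hmB : ∀ i < N, g * m i ∈ B * B) (P : Finset ℕ)
    (hP : ∀ p ∈ P, p.Prime) (h1 : ∀ p ∈ P, ∃ i < N, p ∣ m i)
    (h2 : ∀ i < N, (P.filter (fun p => p ∣ m i)).card ≤ K) : P.card ≤ K * (B.card + 1) := by
  classical
  let φ : ℕ → (ℕ → ℚ) := fun n p => (n.factorization p : ℚ)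
  have hφ : ∀ x y, 0 < x → 0 < y → φ (x * y) = φ x + φ y := by
    intro x y hx hy
    funext p
    simp [φ, Nat.factorization_mul hx.ne' hy.ne']
  have hz : ∀ p ∈ P, ∀ i < N, (φ (m i) p ≠ 0 ↔ p ∣ m i) := by
    intro p hp i hi
    have := (hP p hp).dvd_iff_one_le_factorization (hm i hi).ne'
    simp only [φ, ne_eq, Nat.cast_eq_zero]
    omega
  let w := insert (φ g) (B.image φ)
  have hw : w.card ≤ B.card + 1 :=
    (Finset.card_insert_le _ _).trans (by gcongr; exact Finset.card_image_le)
  refine (key_rank K ((Finset.range N).image (fun i => φ (m i))) w ?_ P ?_ ?_).trans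
    (by gcongr)
  · intro x hx
    obtain ⟨i, hi, rfl⟩ := Finset.mem_image.1 hx
    rw [Finset.mem_range] at hi
    obtain ⟨b, hb, c, hc, hbc⟩ := Finset.mem_mul.1 (hmB i hi)
    have e : φ (m i) = φ b + φ c - φ g := by
      rw [← hφ b c (hB b hb) (hB c hc), hbc, hφ _ _ hg (hm i hi)]
      abel
    simp only [e]
    have hs : ∀ y ∈ w, y ∈ Submodule.span ℚ (w : Set (ℕ → ℚ)) :=
      fun y hy => Submodule.subset_span hy
    refine Submodule.sub_mem _ (Submodule.add_mem _ (hs _ ?_) (hs _ ?_)) (hs _ ?_)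
    · exact Finset.mem_insert_of_mem (Finset.mem_image_of_mem _ hb)
    · exact Finset.mem_insert_of_mem (Finset.mem_image_of_mem _ hc)
    · exact Finset.mem_insert_self _ _
  · intro p hp
    obtain ⟨i, hi, hd⟩ := h1 p hp
    exact ⟨_, Finset.mem_image_of_mem _ (Finset.mem_range.2 hi), (hz p hp i hi).2 hd⟩
  · intro x hx
    obtain ⟨i, hi, rfl⟩ := Finset.mem_image.1 hx
    rw [Finset.mem_range] at hi
    refine le_trans (le_of_eq ?_) (h2 i hi)
    congr 1
    exact Finset.filter_congr (fun p hp => hz p hp i hi)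

/-- few large prime factors -/
lemma few_primes (N m k : ℕ) (hN : 1 < N) (hm : 0 < m) (hlt : m < N ^ k) (P : Finset ℕ)
    (hP : ∀ p ∈ P, p.Prime) (hb : ∀ p ∈ P, N < p * p) :
    (P.filter (fun p => p ∣ m)).card ≤ 2 * k := by
  set Q := P.filter (fun p => p ∣ m) with hQ
  have hdvd : ∏ p ∈ Q, p ∣ m := by
    refine Finset.prod_primes_dvd m (fun p hp => ?_) (fun p hp => ?_)
    · exact (hP p (Finset.mem_filter.1 hp).1).prime
    · exact (Finset.mem_filter.1 hp).2
  have hle := Nat.le_of_dvd hm hdvd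
  have h1 : N ^ Q.card ≤ (∏ p ∈ Q, p) * (∏ p ∈ Q, p) := by
    rw [← Finset.prod_mul_distrib, ← Finset.prod_const]
    exact Finset.prod_le_prod' (fun p hp => (hb p (Finset.mem_filter.1 hp).1).le)
  have h2 : N ^ Q.card ≤ N ^ (2 * k) := by
    calc _ ≤ _ := h1
      _ ≤ N ^ k * N ^ k := Nat.mul_le_mul (hle.trans hlt.le) (hle.trans hlt.le)
      _ = _ := by rw [← pow_add]; congr 1; ring
  exact (Nat.pow_le_pow_iff_right hN).1 h2

lemma exists_dvd (a d p : ℕ) (hp : p.Prime) (hd : ¬ p ∣ d) : ∃ i < p, p ∣ a + i * d := by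
  have := Fact.mk hp
  have hd' : (d : ZMod p) ≠ 0 := by rwa [Ne, ZMod.natCast_eq_zero_iff]
  refine ⟨(-(a : ZMod p) / d).val, ZMod.val_lt _, ?_⟩
  rw [← ZMod.natCast_eq_zero_iff]
  push_cast
  rw [ZMod.natCast_zmod_val]
  field_simp
  ring

lemma small_case (B : Finset ℕ) (hB : ∀ b ∈ B, 0 < b) (g a d N : ℕ) (hg : 0 < g) (ha : 0 < a)
    (hd : 0 < d) (hN : 1 < N) (haN : a < N ^ 10) (hdN : d < N ^ 10)
    (hmB : ∀ i < N, g * (a + i * d) ∈ B * B) :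
    Nat.primeCounting N ≤ 24 * (B.card + 1) + 24 + (Nat.sqrt N + 1) := by
  classical
  set P := (Nat.primesLE N).filter (fun p => N < p * p ∧ ¬ p ∣ d) with hPdef
  have hpr : ∀ p ∈ Nat.primesLE N, p.Prime ∧ p ≤ N := by
    intro p hp
    rw [Nat.mem_primesLE] at hp
    exact ⟨hp.2, hp.1⟩
  have hP : P.card ≤ 24 * (B.card + 1) := by
    refine combine B hB g N 24 (fun i => a + i * d) hg (fun i _ => by positivity) hmB P ?_ ?_ ?_
    · intro p hp
      exact (hpr p (Finset.mem_filter.1 hp).1).1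
    · intro p hp
      obtain ⟨h0, h1, h2⟩ := Finset.mem_filter.1 hp
      obtain ⟨i, hi, h⟩ := exists_dvd a d p (hpr p h0).1 h2
      exact ⟨i, hi.trans_le (hpr p h0).2, h⟩
    · intro i hi
      refine few_primes N (a + i * d) 12 hN (by positivity) ?_ P ?_ ?_
      · have : i * d ≤ N * N ^ 10 := Nat.mul_le_mul hi.le hdN.le
        have h3 : N ^ 12 = N * (N * N ^ 10) := by ring
        have h4 : N ^ 10 ≤ N * N ^ 10 := Nat.le_mul_of_pos_left _ (by omega)
        have h5 : 2 * (N * N ^ 10) ≤ N * (N * N ^ 10) := Nat.mul_le_mul_right _ hN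
        omega
      · intro p hp
        exact (hpr p (Finset.mem_filter.1 hp).1).1
      · intro p hp
        exact (Finset.mem_filter.1 hp).2.1
  set Q := (Nat.primesLE N).filter (fun p => N < p * p) with hQdef
  have hQ : (Q.filter (fun p => p ∣ d)).card ≤ 2 * 12 := by
    refine few_primes N d 12 hN hd ?_ Q ?_ ?_
    · exact hdN.trans_le (Nat.pow_le_pow_right (by omega) (by norm_num))
    · intro p hp
      exact (hpr p (Finset.mem_filter.1 hp).1).1
    · intro p hp
      exact (Finset.mem_filter.1 hp).2
  rw [← Nat.primesLE_card_eq_primeCounting]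
  have hsub : Nat.primesLE N ⊆ (P ∪ Q.filter (fun p => p ∣ d)) ∪ Finset.range (Nat.sqrt N + 1) := by
    intro p hp
    simp only [hPdef, hQdef, Finset.mem_union, Finset.mem_filter, Finset.mem_range, hp, true_and]
    by_cases h : N < p * p
    · tauto
    · right
      have := Nat.le_sqrt.2 (not_lt.1 h)
      omega
  have := Finset.card_le_card hsub
  have h1 := Finset.card_union_le (P ∪ Q.filter (fun p => p ∣ d)) (Finset.range (Nat.sqrt N + 1))
  have h2 := Finset.card_union_le P (Q.filter (fun p => p ∣ d))
  rw [Finset.card_range] at h1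
  omega

lemma prod_dist (j k : ℕ) :
    ∏ i ∈ (Finset.range (j + 1 + k)).erase j, ((i - j) + (j - i)) = j.factorial * k.factorial := by
  have h1 : ∏ i ∈ (Finset.range (j + 1 + k)).erase j, ((i - j) + (j - i))
      = ∏ i ∈ Finset.range (j + 1 + k), (if i = j then 1 else ((i - j) + (j - i))) := by
    rw [← Finset.mul_prod_erase (Finset.range (j + 1 + k)) _
      (Finset.mem_range.2 (by omega : j < j + 1 + k))]
    rw [if_pos rfl, one_mul]
    refine Finset.prod_congr rfl (fun i hi => ?_)
    rw [if_neg (Finset.ne_of_mem_erase hi)]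
  rw [h1, Finset.prod_range_add, Finset.prod_range_succ, if_pos rfl, mul_one]
  congr 1
  · rw [← Finset.prod_range_add_one_eq_factorial, ← Finset.prod_range_reflect]
    refine Finset.prod_congr rfl (fun i hi => ?_)
    have := Finset.mem_range.1 hi
    rw [if_neg (by omega)]
    omega
  · rw [← Finset.prod_range_add_one_eq_factorial]
    refine Finset.prod_congr rfl (fun i hi => ?_)
    rw [if_neg (by omega)]
    omega

lemma dist_dvd (a d i j q : ℕ) (hc : Nat.Coprime q d) (hi : q ∣ a + i * d) (hj : q ∣ a + j * d) :
    q ∣ (i - j) + (j - i) := by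
  refine hc.dvd_of_dvd_mul_right ?_
  rcases le_total i j with h | h
  · have := Nat.dvd_sub hj hi
    rw [Nat.sub_eq_zero_of_le h, zero_add, Nat.sub_mul]
    rwa [Nat.add_sub_add_left] at this
  · have := Nat.dvd_sub hi hj
    rw [Nat.sub_eq_zero_of_le h, add_zero, Nat.sub_mul]
    rwa [Nat.add_sub_add_left] at this

lemma prime_coprime_d (a d i p : ℕ) (hp : p.Prime) (hc : Nat.Coprime a d) (h : p ∣ a + i * d) :
    Nat.Coprime p d := by
  rw [hp.coprime_iff_not_dvd]
  intro hd
  have : p ∣ a := (Nat.dvd_add_left (hd.mul_left i)).1 h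
  exact hp.one_lt.ne' (Nat.dvd_one.1 (hc ▸ Nat.dvd_gcd this hd))

lemma smooth_count (a d N : ℕ) (hN : 1 < N) (hd : 0 < d) (ha : 0 < a) (hc : Nat.Coprime a d)
    (hbig : ∀ i, 1 ≤ i → N ^ 10 ≤ a + i * d) (T : Finset ℕ) (hT : T ⊆ Finset.Ico 1 N)
    (hs : ∀ i ∈ T, ∀ p, p.Prime → p ∣ a + i * d → p ≤ N) :
    10 * T.card ≤ N + 10 * Nat.primeCounting N := by
  classical
  rcases T.eq_empty_or_nonempty with rfl | hne
  · simp
  choose J hJT hJ using fun p : ℕ =>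
    Finset.exists_max_image T (fun i => (a + i * d).factorization p) hne
  set T' := T \ (Nat.primesLE N).image J with hT'
  have hcard : T.card ≤ T'.card + Nat.primeCounting N := by
    have h1 : T.card - ((Nat.primesLE N).image J).card ≤ T'.card := Finset.le_card_sdiff _ _
    have h2 : ((Nat.primesLE N).image J).card ≤ _ := Finset.card_image_le
    rw [Nat.primesLE_card_eq_primeCounting] at h2
    omega
  have hpos : ∀ i, a + i * d ≠ 0 := fun i => by positivity
  have hdvd : ∏ i ∈ T', (a + i * d) ∣ (N - 1).factorial := by
    rw [← Nat.factorization_prime_le_iff_dvd (Finset.prod_ne_zero_iff.2 fun i _ => hpos i)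
      (Nat.factorial_ne_zero _)]
    intro p hp
    rw [Nat.factorization_prod fun i _ => hpos i, Finsupp.finsetSum_apply]
    by_cases hpN : p ≤ N
    · set j := J p with hj
      have hjN := Finset.mem_Ico.1 (hT (hJT p))
      have hsub : T' ⊆ (Finset.range N).erase j := by
        intro i hi
        obtain ⟨hi1, hi2⟩ := Finset.mem_sdiff.1 hi
        refine Finset.mem_erase.2 ⟨?_, Finset.mem_range.2 (Finset.mem_Ico.1 (hT hi1)).2⟩
        rintro rfl
        exact hi2 (Finset.mem_image_of_mem _ (Nat.mem_primesLE.2 ⟨hpN, hp⟩))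
      have hD : ∀ i ∈ (Finset.range N).erase j, (i - j) + (j - i) ≠ 0 := by
        intro i hi
        have := Finset.ne_of_mem_erase hi
        omega
      have hprod := prod_dist j (N - 1 - j)
      rw [show j + 1 + (N - 1 - j) = N by omega] at hprod
      have hfd : ∏ i ∈ (Finset.range N).erase j, ((i - j) + (j - i)) ∣ (N - 1).factorial := by
        rw [hprod]
        exact Nat.factorial_mul_factorial_dvd_factorial (by omega)
      calc ∑ i ∈ T', (a + i * d).factorization p
          ≤ ∑ i ∈ T', ((i - j) + (j - i)).factorization p := by
            refine Finset.sum_le_sum (fun i hi => ?_)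
            have hiT := (Finset.mem_sdiff.1 hi).1
            rcases Nat.eq_zero_or_pos ((a + i * d).factorization p) with h0 | h0
            · omega
            have hpd : p ∣ a + i * d := Nat.dvd_of_factorization_pos h0.ne'
            refine (hp.pow_dvd_iff_le_factorization (hD i (hsub hi))).1 ?_
            refine dist_dvd a d i j _ ((prime_coprime_d a d i p hp hc hpd).pow_left _) ?_ ?_
            · exact Nat.ordProj_dvd _ _
            · exact (hp.pow_dvd_iff_le_factorization (hpos j)).2 (hJ p i hiT)
        _ ≤ ∑ i ∈ (Finset.range N).erase j, ((i - j) + (j - i)).factorization p :=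
            Finset.sum_le_sum_of_subset hsub
        _ = (∏ i ∈ (Finset.range N).erase j, ((i - j) + (j - i))).factorization p := by
            rw [Nat.factorization_prod hD, Finsupp.finsetSum_apply]
        _ ≤ _ := (Nat.factorization_le_iff_dvd (Finset.prod_ne_zero_iff.2 hD)
            (Nat.factorial_ne_zero _)).2 hfd p
    · rw [Finset.sum_eq_zero]
      · exact Nat.zero_le _
      · intro i hi
        refine Nat.factorization_eq_zero_of_not_dvd (fun h => hpN ?_)
        exact hs i (Finset.mem_sdiff.1 hi).1 p hp h
  have hle := Nat.le_of_dvd (Nat.factorial_pos _) hdvd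
  have h1 : (N ^ 10) ^ T'.card ≤ ∏ i ∈ T', (a + i * d) := by
    rw [← Finset.prod_const]
    exact Finset.prod_le_prod' (fun i hi =>
      hbig i (Finset.mem_Ico.1 (hT (Finset.mem_sdiff.1 hi).1)).1)
  have h2 : (N - 1).factorial ≤ N ^ N :=
    (Nat.factorial_le (Nat.sub_le _ _)).trans (Nat.factorial_le_pow N)
  rw [← pow_mul] at h1
  have := (Nat.pow_le_pow_iff_right hN).1 (h1.trans (hle.trans h2))
  omega

lemma pi_half (N : ℕ) : 2 * Nat.primeCounting N ≤ N + 4 := by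
  rcases Nat.lt_or_ge N 2 with h | h
  · interval_cases N <;> simp
  · obtain ⟨n, rfl⟩ := Nat.exists_eq_add_of_le h
    have := Nat.primeCounting_add_le (a := 2) (k := 2) (by norm_num) (by norm_num) n
    have h2 : Nat.primeCounting 2 = 1 := by decide
    rw [h2, Nat.totient_two] at this
    omega

lemma big_case (B : Finset ℕ) (hB : ∀ b ∈ B, 0 < b) (g a d N : ℕ) (hg : 0 < g) (ha : 0 < a)
    (hd : 0 < d) (hN : 1 < N) (hc : Nat.Coprime a d)
    (hbig : ∀ i, 1 ≤ i → N ^ 10 ≤ a + i * d)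
    (hmB : ∀ i < N, g * (a + i * d) ∈ B * B) :
    4 * N ≤ 10 * B.card + 40 := by
  classical
  set T := (Finset.Ico 1 N).filter (fun i => ∀ p, p.Prime → p ∣ a + i * d → p ≤ N) with hT
  set U := (Finset.Ico 1 N).filter (fun i => ¬ ∀ p, p.Prime → p ∣ a + i * d → p ≤ N) with hU
  have hTU : T.card + U.card = N - 1 := by
    rw [hT, hU, Finset.card_filter_add_card_filter_not, Nat.card_Ico]
  have h1 := smooth_count a d N hN hd ha hc hbig T (Finset.filter_subset _ _)
    (fun i hi => (Finset.mem_filter.1 hi).2)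
  have h2 := pi_half N
  have hex : ∀ i, ∃ p, i ∈ U → p.Prime ∧ p ∣ a + i * d ∧ N < p := by
    intro i
    by_cases hi : i ∈ U
    · have := (Finset.mem_filter.1 hi).2
      push Not at this
      obtain ⟨p, h⟩ := this
      exact ⟨p, fun _ => h⟩
    · exact ⟨0, fun h => absurd h hi⟩
  choose q hq using hex
  have huniq : ∀ i ∈ U, ∀ k < N, q i ∣ a + k * d → k = i := by
    intro i hi k hk hdv
    obtain ⟨hp, hpd, hpN⟩ := hq i hi
    have hdd := dist_dvd a d i k (q i) (prime_coprime_d a d i _ hp hc hpd) hpd hdv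
    have hiN := (Finset.mem_Ico.1 (Finset.mem_filter.1 hi).1).2
    by_contra hne
    have := Nat.le_of_dvd (by omega) hdd
    omega
  have hUc : (U.image q).card = U.card := by
    refine Finset.card_image_of_injOn (fun i hi k hk h => ?_)
    have hkN := (Finset.mem_Ico.1 (Finset.mem_filter.1 hk).1).2
    have h : q i = q k := h
    exact (huniq i hi k hkN (h ▸ (hq k hk).2.1)).symm
  have h3 : (U.image q).card ≤ 1 * (B.card + 1) := by
    refine combine B hB g N 1 (fun i => a + i * d) hg (fun i _ => by positivity) hmB _ ?_ ?_ ?_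
    · intro p hp
      obtain ⟨i, hi, rfl⟩ := Finset.mem_image.1 hp
      exact (hq i hi).1
    · intro p hp
      obtain ⟨i, hi, rfl⟩ := Finset.mem_image.1 hp
      exact ⟨i, (Finset.mem_Ico.1 (Finset.mem_filter.1 hi).1).2, (hq i hi).2.1⟩
    · intro k hk
      rw [Finset.card_le_one]
      intro x hx y hy
      obtain ⟨hx1, hx2⟩ := Finset.mem_filter.1 hx
      obtain ⟨hy1, hy2⟩ := Finset.mem_filter.1 hy
      obtain ⟨i, hi, rfl⟩ := Finset.mem_image.1 hx1
      obtain ⟨j, hj, rfl⟩ := Finset.mem_image.1 hy1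
      rw [← huniq i hi k hk hx2, ← huniq j hj k hk hy2]
  omega

lemma analytic (N n : ℕ) (hN : 10 ^ 8 ≤ N)
    (h : Nat.primeCounting N ≤ 24 * (n + 1) + 24 + (Nat.sqrt N + 1)) :
    (N : ℝ) ≤ 96 * n * Real.log N := by
  have hNR : (10 : ℝ) ^ 8 ≤ N := by exact_mod_cast hN
  have hN0 : (0 : ℝ) < N := by linarith
  have hL : 0 < Real.log N := Real.log_pos (by linarith)
  have hpi := Chebyshev.pi_ge N
  rw [div_le_iff₀ hL] at hpi
  set u : ℝ := (N : ℝ) ^ (1 / 4 : ℝ) with hu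
  have hu0 : 0 ≤ u := by positivity
  have hu4 : u ^ 4 = N := by
    rw [hu, ← Real.rpow_natCast, ← Real.rpow_mul hN0.le]; norm_num
  have hu100 : 100 ≤ u := by
    by_contra hlt
    push Not at hlt
    have : u ^ 4 < 100 ^ 4 := pow_lt_pow_left₀ hlt hu0 (by norm_num)
    rw [hu4] at this
    norm_num at this hNR
    linarith
  have hlog : Real.log N ≤ 4 * u := by
    have := Real.log_le_rpow_div hN0.le (show (0 : ℝ) < 1 / 4 by norm_num)
    rw [← hu] at this
    linarith
  have hlog1 : Real.log (N + 1) ≤ 1 + 4 * u := by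
    have h1 : Real.log (N + 1) ≤ Real.log (N * 2) := Real.log_le_log (by linarith) (by linarith)
    rw [Real.log_mul hN0.ne' (by norm_num)] at h1
    have := Real.log_two_lt_d9
    linarith
  have hsq : (Nat.sqrt N : ℝ) ≤ u ^ 2 := by
    have h1 : ((Nat.sqrt N : ℝ)) ^ 2 ≤ (u ^ 2) ^ 2 := by
      rw [← pow_mul, hu4]
      exact_mod_cast Nat.sqrt_le' N
    exact le_of_sq_le_sq h1 (by positivity)
  have hR : (Nat.primeCounting N : ℝ) ≤ 24 * n + 49 + u ^ 2 := by
    have : (Nat.primeCounting N : ℝ) ≤ 24 * (n + 1) + 24 + (Nat.sqrt N + 1) := by exact_mod_cast h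
    linarith
  have h1 : (Nat.primeCounting N : ℝ) * Real.log N ≤ 24 * n * Real.log N + (49 + u ^ 2) * (4 * u) := by
    calc _ ≤ (24 * n + 49 + u ^ 2) * Real.log N := by gcongr
      _ = 24 * n * Real.log N + (49 + u ^ 2) * Real.log N := by ring
      _ ≤ _ := by gcongr
  have h2 := Real.log_two_gt_d9
  have h3 : (N : ℝ) * 0.69 ≤ N * Real.log 2 := by gcongr; linarith
  have h4 : (49 + u ^ 2) * (4 * u) + (1 + 4 * u) ≤ 0.44 * u ^ 4 := by
    have a1 : 100 * u ^ 3 ≤ u ^ 4 := by nlinarith [pow_nonneg hu0 3]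
    have a2 : 100 * u ^ 2 ≤ u ^ 3 := by nlinarith [pow_nonneg hu0 2]
    nlinarith
  rw [hu4] at h4
  linarith

theorem ap_in_product_set :
    ∃ C : ℝ, 0 < C ∧ ∃ n₀ : ℕ, ∀ B : Finset ℕ, (∀ b ∈ B, 0 < b) → n₀ ≤ B.card →
      ∀ a d N : ℕ, 0 < a → 0 < d →
        (∀ i < N, a + i * d ∈ B * B) →
        (N : ℝ) ≤ C * B.card * Real.log B.card := by
  refine ⟨10 ^ 8, by norm_num, 3, ?_⟩
  intro B hB hn a d N ha hd hAP
  have hnR : (3 : ℝ) ≤ B.card := by exact_mod_cast hn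
  have hlog : 1 ≤ Real.log B.card := by
    rw [Real.le_log_iff_exp_le (by linarith)]
    linarith [Real.exp_one_lt_d9]
  have hprod : (B.card : ℝ) ≤ B.card * Real.log B.card := by nlinarith
  rcases Nat.lt_or_ge N (10 ^ 8) with hN | hN
  · have : (N : ℝ) ≤ 10 ^ 8 := by exact_mod_cast hN.le
    nlinarith
  -- reduce to coprime case
  obtain ⟨g, a', d', hg, hc, rfl, rfl⟩ := Nat.exists_coprime' (m := a) (n := d)
    (Nat.gcd_pos_of_pos_left _ ha)
  have ha' : 0 < a' := Nat.pos_of_mul_pos_right ha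
  have hd' : 0 < d' := Nat.pos_of_mul_pos_right hd
  have hmB : ∀ i < N, g * (a' + i * d') ∈ B * B := by
    intro i hi
    have := hAP i hi
    convert this using 1
    ring
  have hN1 : 1 < N := by omega
  by_cases hsm : a' < N ^ 10 ∧ d' < N ^ 10
  · have h1 := analytic N B.card hN
      (small_case B hB g a' d' N hg ha' hd' hN1 hsm.1 hsm.2 hmB)
    have hN2 : N ≤ B.card ^ 2 := by
      have hsub : (Finset.range N).image (fun i => g * (a' + i * d')) ⊆ B * B := by
        intro x hx
        obtain ⟨i, hi, rfl⟩ := Finset.mem_image.1 hx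
        exact hmB i (Finset.mem_range.1 hi)
      have h2 := Finset.card_le_card hsub
      rw [Finset.card_image_of_injective, Finset.card_range] at h2
      · exact h2.trans (Finset.card_mul_le.trans (by rw [sq]))
      · intro i j hij
        have h3 := Nat.eq_of_mul_eq_mul_left hg hij
        exact Nat.eq_of_mul_eq_mul_right hd' (Nat.add_left_cancel h3)
    have hl : Real.log N ≤ 2 * Real.log B.card := by
      have : Real.log N ≤ Real.log ((B.card : ℝ) ^ 2) :=
        Real.log_le_log (by exact_mod_cast (by omega : 0 < N)) (by exact_mod_cast hN2)
      rwa [Real.log_pow] at this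
    have h5 : 96 * (B.card : ℝ) * Real.log N ≤ 96 * B.card * (2 * Real.log B.card) := by gcongr
    nlinarith
  · have hbig : ∀ i, 1 ≤ i → N ^ 10 ≤ a' + i * d' := by
      intro i hi
      have : d' ≤ i * d' := Nat.le_mul_of_pos_left _ hi
      omega
    have h1 := big_case B hB g a' d' N hg ha' hd' hN1 hc hbig hmB
    have h2 : (4 : ℝ) * N ≤ 10 * B.card + 40 := by exact_mod_cast h1
    nlinarith
end

section
/- Let D, r, d be positive integers with gcd(Dr, d) = 1, and let A = {D(r + di) : 0 ≤ i < N} be contained in B·B for a set B of n positive integers. If d < N^k and r < N^k with k = o(log N), then N ≤ 36·k·n·log n for all sufficiently large n. -/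
open scoped Pointwise

lemma aux_rank (S B : Finset ℕ) (D : ℕ) (a P : ℕ → ℕ) (hD : 0 < D)
    (ha : ∀ i ∈ S, 0 < a i) (hB : ∀ i ∈ S, D * a i ∈ B * B)
    (hP : ∀ i ∈ S, (P i).Prime) (hdvd : ∀ i ∈ S, P i ∣ a i)
    (hnd : ∀ i ∈ S, ∀ j ∈ S, i < j → ¬ P i ∣ a j) : S.card ≤ B.card := by
  classical
  have h1 : ∀ i : S, ∃ x y : B, (x : ℕ) * (y : ℕ) = D * a i := by
    intro i
    obtain ⟨x, hx, y, hy, h⟩ := Finset.mem_mul.1 (hB i i.2)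
    exact ⟨⟨x, hx⟩, ⟨y, hy⟩, h⟩
  choose x y hxy using h1
  let v : S → (B → ℚ) := fun i => Pi.single (x i) 1 + Pi.single (y i) 1
  have hv : LinearIndependent ℚ v := by
    rw [Fintype.linearIndependent_iff]
    intro g hg
    have key : ∀ f : B → ℚ, ∑ i, g i * (f (x i) + f (y i)) = 0 := by
      intro f
      have h2 : ∑ b, (∑ i, g i • v i) b * f b = 0 := by rw [hg]; simp
      rw [← h2]
      simp only [Finset.sum_apply, Finset.sum_mul]
      rw [Finset.sum_comm]
      refine Finset.sum_congr rfl fun i _ => ?_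
      simp only [v, Pi.smul_apply, Pi.add_apply, smul_eq_mul, Pi.single_apply, mul_assoc,
        add_mul, mul_add, Finset.sum_add_distrib]
      simp
    have hsum : ∑ i, g i = 0 := by
      have := key (fun _ => 1)
      rw [← Finset.sum_mul] at this
      have h3 : ((1 : ℚ) + 1) ≠ 0 := by norm_num
      exact (mul_eq_zero.1 this).resolve_right h3
    have key2 : ∀ p : ℕ, p.Prime → ∑ i : S, g i * (padicValNat p (a i) : ℚ) = 0 := by
      intro p hp
      have : Fact p.Prime := ⟨hp⟩
      have h4 := key (fun b => (padicValNat p (b : ℕ) : ℚ))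
      have h5 : ∀ i : S, (padicValNat p (x i : ℕ) : ℚ) + padicValNat p (y i : ℕ)
          = padicValNat p D + padicValNat p (a i) := by
        intro i
        have hpos : 0 < (x i : ℕ) * (y i : ℕ) := by
          rw [hxy i]; exact Nat.mul_pos hD (ha i i.2)
        have hx0 : (x i : ℕ) ≠ 0 := by rintro h; simp [h] at hpos
        have hy0 : (y i : ℕ) ≠ 0 := by rintro h; simp [h] at hpos
        have e1 := padicValNat.mul (p := p) hx0 hy0
        rw [hxy i, padicValNat.mul hD.ne' (ha i i.2).ne'] at e1
        exact_mod_cast e1.symm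
      simp only [h5, mul_add, Finset.sum_add_distrib] at h4
      rw [← Finset.sum_mul, hsum] at h4
      simpa using h4
    have main : ∀ n : ℕ, ∀ i : S, (i : ℕ) = n → g i = 0 := by
      intro n
      induction n using Nat.strong_induction_on with
      | _ n ih =>
        intro i hi
        have h6 := key2 (P i) (hP i i.2)
        have : Fact (P i).Prime := ⟨hP i i.2⟩
        rw [Finset.sum_eq_single i] at h6
        · have h7 : 1 ≤ padicValNat (P i) (a i) :=
            one_le_padicValNat_of_dvd (ha i i.2).ne' (hdvd i i.2)
          have h8 : (padicValNat (P i) (a i) : ℚ) ≠ 0 := by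
            exact_mod_cast (by omega : padicValNat (P i) (a i) ≠ 0)
          exact (mul_eq_zero.1 h6).resolve_right h8
        · intro j _ hji
          rcases lt_trichotomy (j : ℕ) (i : ℕ) with h | h | h
          · rw [ih j (hi ▸ h) j rfl, zero_mul]
          · exact absurd (Subtype.ext h) hji
          · rw [padicValNat.eq_zero_of_not_dvd (hnd i i.2 j j.2 h)]; simp
        · simp
    exact fun i => main i i rfl
  simpa using hv.fintype_card_le_finrank

lemma aux_count (T : Finset ℕ) (N m K : ℕ) (hN : 1 < N) (hT : ∀ p ∈ T, p.Prime ∧ N < p ^ 2 ∧ p ∣ m)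
    (hm : 0 < m) (hmK : m ^ 2 < N ^ K) : T.card < K := by
  have h1 : ∏ p ∈ T, p ∣ m :=
    Finset.prod_primes_dvd m (fun p hp => (hT p hp).1.prime) (fun p hp => (hT p hp).2.2)
  have h2 : N ^ T.card ≤ m ^ 2 := by
    calc N ^ T.card = ∏ _p ∈ T, N := by simp
      _ ≤ ∏ p ∈ T, p ^ 2 := Finset.prod_le_prod' fun p hp => (hT p hp).2.1.le
      _ = (∏ p ∈ T, p) ^ 2 := by rw [Finset.prod_pow]
      _ ≤ m ^ 2 := Nat.pow_le_pow_left (Nat.le_of_dvd hm h1) 2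
  exact (Nat.pow_lt_pow_iff_right hN).1 (h2.trans_lt hmK)

lemma aux_last (p r d N : ℕ) (hp : p.Prime) (hpN : p ≤ N) (hd : ¬ p ∣ d) :
    ∃ i < N, p ∣ r + d * i ∧ ∀ j < N, i < j → ¬ p ∣ r + d * j := by
  classical
  have : Fact p.Prime := ⟨hp⟩
  let T := (Finset.range N).filter fun i => p ∣ r + d * i
  have hne : T.Nonempty := by
    refine ⟨(-(r : ZMod p) / d).val, ?_⟩
    simp only [T, Finset.mem_filter, Finset.mem_range]
    refine ⟨(ZMod.val_lt _).trans_le hpN, ?_⟩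
    rw [← ZMod.natCast_eq_zero_iff]
    have : (d : ZMod p) ≠ 0 := by rwa [Ne, ZMod.natCast_eq_zero_iff]
    push_cast
    rw [ZMod.natCast_zmod_val]
    field_simp
    ring
  have hmem := T.max'_mem hne
  simp only [T, Finset.mem_filter, Finset.mem_range] at hmem
  refine ⟨T.max' hne, hmem.1, hmem.2, fun j hj hlt hdj => ?_⟩
  have : j ∈ T := by simp [T, hj, hdj]
  exact absurd (T.le_max' j this) (not_le.2 hlt)

lemma aux_comb (B : Finset ℕ) (D r d N k : ℕ) (hD : 0 < D) (hr : 0 < r) (hd : 0 < d)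
    (hN : 1 < N) (hB : ∀ i < N, D * (r + d * i) ∈ B * B)
    (hdN : d < N ^ k) (hrN : r < N ^ k) :
    Nat.primeCounting N ≤ Nat.sqrt N + 2 * k + (2 * k + 2) * B.card := by
  classical
  let Q := (Nat.primesLE N).filter fun p => N < p ^ 2 ∧ ¬ p ∣ d
  have hQ : ∀ p ∈ Q, p.Prime ∧ p ≤ N ∧ N < p ^ 2 ∧ ¬ p ∣ d := by
    intro p hp
    simp only [Q, Finset.mem_filter, Nat.mem_primesLE] at hp
    tauto
  have hex : ∀ p, ∃ i, p ∈ Q → (i < N ∧ p ∣ r + d * i ∧ ∀ j < N, i < j → ¬ p ∣ r + d * j) := by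
    intro p
    by_cases hp : p ∈ Q
    · obtain ⟨i, h1, h2⟩ := aux_last p r d N (hQ p hp).1 (hQ p hp).2.1 (hQ p hp).2.2.2
      exact ⟨i, fun _ => ⟨h1, h2⟩⟩
    · exact ⟨0, fun h => absurd h hp⟩
  choose f hf using hex
  let S := Q.image f
  have hSP : ∀ i, ∃ p, i ∈ S → p ∈ Q ∧ f p = i := by
    intro i
    by_cases hi : i ∈ S
    · obtain ⟨p, hp⟩ := Finset.mem_image.1 hi
      exact ⟨p, fun _ => hp⟩
    · exact ⟨0, fun h => absurd h hi⟩
  choose P hP using hSP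
  have hSN : ∀ i ∈ S, i < N := by
    intro i hi
    have := hP i hi
    rw [← this.2]; exact (hf _ this.1).1
  have hSB : S.card ≤ B.card := by
    refine aux_rank S B D (fun i => r + d * i) P hD (fun i _ => by positivity)
      (fun i hi => hB i (hSN i hi)) (fun i hi => (hQ _ (hP i hi).1).1) ?_ ?_
    · intro i hi
      have h1 := hP i hi
      have h2 := (hf _ h1.1).2.1
      rwa [h1.2] at h2
    · intro i hi j hj hij
      have h1 := hP i hi
      have h2 := (hf _ h1.1).2.2 j (hSN j hj)
      rw [h1.2] at h2
      exact h2 hij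
  have hQS : Q.card ≤ (2 * k + 2) * S.card := by
    refine Finset.card_le_mul_card_image Q _ fun i hi => ?_
    refine (aux_count _ N (r + d * i) (2 * k + 2) hN ?_ (by positivity) ?_).le
    · intro p hp
      obtain ⟨hp1, hp2⟩ := Finset.mem_filter.1 hp
      have := hf p hp1
      rw [hp2] at this
      exact ⟨(hQ p hp1).1, (hQ p hp1).2.2.1, this.2.1⟩
    · have hiN := hSN i hi
      have h3 : r + d * i < N ^ (k + 1) := by
        calc r + d * i < N ^ k + N ^ k * i := by
              have := Nat.mul_le_mul_right i hdN.le
              omega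
          _ = N ^ k * (i + 1) := by ring
          _ ≤ N ^ k * N := Nat.mul_le_mul_left _ hiN
          _ = N ^ (k + 1) := by ring
      calc (r + d * i) ^ 2 < (N ^ (k + 1)) ^ 2 := Nat.pow_lt_pow_left h3 (by norm_num)
        _ = N ^ (2 * k + 2) := by ring
  let R := (Nat.primesLE N).filter fun p => N < p ^ 2 ∧ p ∣ d
  have hR : R.card < 2 * k := by
    refine aux_count R N d (2 * k) hN ?_ hd ?_
    · intro p hp
      simp only [R, Finset.mem_filter, Nat.mem_primesLE] at hp
      tauto
    · calc d ^ 2 < (N ^ k) ^ 2 := Nat.pow_lt_pow_left hdN (by norm_num)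
        _ = N ^ (2 * k) := by ring
  have hsub : Nat.primesLE N ⊆ (Finset.Icc 1 (Nat.sqrt N) ∪ R) ∪ Q := by
    intro p hp
    have hp' := Nat.mem_primesLE.1 hp
    simp only [Finset.mem_union, R, Q, Finset.mem_filter, hp, true_and, Finset.mem_Icc]
    by_cases h : N < p ^ 2
    · tauto
    · left; left
      exact ⟨hp'.2.one_lt.le, Nat.le_sqrt'.2 (not_lt.1 h)⟩
  have hc := Finset.card_le_card hsub
  have h4 := Finset.card_union_le (Finset.Icc 1 (Nat.sqrt N) ∪ R) Q
  have h5 := Finset.card_union_le (Finset.Icc 1 (Nat.sqrt N)) R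
  rw [Nat.primesLE_card_eq_primeCounting] at hc
  have h6 : (Finset.Icc 1 (Nat.sqrt N)).card = Nat.sqrt N := by simp
  have h7 := Nat.mul_le_mul_left (2 * k + 2) hSB
  omega

/-- Lemma 4 of the earlier paper: if the progression `{D(r+di) : 0 ≤ i < N}` with
`gcd(Dr, d) = 1`, `d, r < N^k` and `k ≤ (log N)/100` is contained in `B·B`, then
`N ≤ 36·k·n·log n` for `n = |B|` sufficiently large. -/
theorem small_params_ap_bound :
    ∃ n₀ : ℕ, ∀ (B : Finset ℕ) (D r d N k : ℕ),
      0 < D → 0 < r → 0 < d → Nat.gcd (D * r) d = 1 →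
      (∀ i < N, D * (r + d * i) ∈ B * B) →
      d < N ^ k → r < N ^ k → (k : ℝ) ≤ Real.log N / 100 →
      n₀ ≤ B.card →
      (N : ℝ) ≤ 36 * k * B.card * Real.log B.card := by
  refine ⟨0, fun B D r d N k hD hr hd _ hB hdN hrN hk _ => ?_⟩
  have hk1 : 1 ≤ k := by
    rcases Nat.eq_zero_or_pos k with h | h
    · subst h; simp at hdN; omega
    · exact h
  have hk1R : (1 : ℝ) ≤ k := by exact_mod_cast hk1
  have hL : 100 ≤ Real.log N := by linarith
  have hN0 : 0 < N := by
    rcases Nat.eq_zero_or_pos N with h | h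
    · subst h; simp at hL; linarith
    · exact h
  have hN1 : 1 < N := by
    rcases Nat.lt_or_ge 1 N with h | h
    · exact h
    · have : N = 1 := by omega
      subst this; simp at hL; linarith
  have hNR : (0 : ℝ) < N := by exact_mod_cast hN0
  have hcomb := aux_comb B D r d N k hD hr hd hN1 hB hdN hrN
  -- N ≤ n ^ 2
  have hcard : N ≤ B.card ^ 2 := by
    have h1 : ((Finset.range N).image fun i => D * (r + d * i)) ⊆ B * B := by
      intro z hz
      obtain ⟨i, hi, rfl⟩ := Finset.mem_image.1 hz
      exact hB i (Finset.mem_range.1 hi)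
    have h2 := Finset.card_le_card h1
    rw [Finset.card_image_of_injective] at h2
    · have h3 := Finset.card_mul_le (s := B) (t := B)
      rw [Finset.card_range] at h2
      nlinarith
    · intro i j hij
      have h4 := Nat.eq_of_mul_eq_mul_left hD hij
      exact Nat.eq_of_mul_eq_mul_left hd (Nat.add_left_cancel h4)
  have hlog : Real.log N ≤ 2 * Real.log B.card := by
    have : (N : ℝ) ≤ (B.card : ℝ) ^ 2 := by exact_mod_cast hcard
    have h := Real.log_le_log hNR this
    rw [Real.log_pow] at h
    exact_mod_cast h
  -- analytic part
  set L := Real.log N with hLdef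
  set u := Real.exp (L / 4) with hu
  have hu1 : L / 4 + 1 ≤ u := Real.add_one_le_exp _
  have hu4 : (N : ℝ) = u ^ 4 := by
    rw [hu, ← Real.exp_nat_mul, ← Real.exp_log hNR]
    congr 1
    push_cast
    rw [← hLdef]; ring
  clear_value u
  have hupos : 0 < u := by linarith
  have hsq : (Nat.sqrt N : ℝ) ≤ u ^ 2 := by
    have h1 : ((Nat.sqrt N : ℝ)) ^ 2 ≤ N := by exact_mod_cast Nat.sqrt_le' N
    rw [hu4] at h1
    refine le_of_sq_le_sq ?_ (by positivity)
    calc ((Nat.sqrt N : ℝ)) ^ 2 ≤ u ^ 4 := h1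
      _ = (u ^ 2) ^ 2 := by ring
  have hpi := Chebyshev.pi_ge N
  have hLpos : 0 < L := by linarith
  rw [← hLdef, div_le_iff₀ hLpos] at hpi
  have hlogN1 : Real.log ((N : ℝ) + 1) ≤ 2 * L := by
    have h2 : (N : ℝ) + 1 ≤ (N : ℝ) ^ 2 := by
      have : (2 : ℝ) ≤ N := by exact_mod_cast hN1
      nlinarith
    have h := Real.log_le_log (by positivity) h2
    rw [Real.log_pow] at h
    exact_mod_cast h
  have hlog2 := Real.log_two_gt_d9
  have hcR : (Nat.primeCounting N : ℝ) ≤ Nat.sqrt N + 2 * k + (2 * k + 2) * B.card := by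
    exact_mod_cast hcomb
  have hu26 : 26 ≤ u := by linarith
  have hLu : L ≤ 4 * u := by linarith
  have hn0 : (0 : ℝ) ≤ B.card := Nat.cast_nonneg _
  -- lower bound for the prime count
  have hpi2 : 0.69 * u ^ 4 ≤ Nat.primeCounting N * L + 8 * u := by
    have : (0.69 : ℝ) * u ^ 4 ≤ N * Real.log 2 := by
      rw [hu4, mul_comm]
      exact mul_le_mul_of_nonneg_left (by linarith) (by positivity)
    linarith
  have hA : (Nat.sqrt N : ℝ) * L ≤ u ^ 2 * (4 * u) :=
    mul_le_mul hsq hLu hLpos.le (by positivity)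
  have hKL : (k : ℝ) * L ≤ u * (4 * u) :=
    mul_le_mul (by linarith) hLu hLpos.le (by positivity)
  have hC : (Nat.primeCounting N : ℝ) * L ≤
      Nat.sqrt N * L + 2 * (k * L) + 4 * (k * B.card * L) := by
    have h1 := mul_le_mul_of_nonneg_right hcR hLpos.le
    have h2 : (B.card : ℝ) * L ≤ k * (B.card * L) :=
      le_mul_of_one_le_left (mul_nonneg hn0 hLpos.le) hk1R
    nlinarith
  have hE : 18 * (k * B.card * L) ≤ 36 * k * B.card * Real.log B.card := by
    have := mul_le_mul_of_nonneg_left hlog 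
      (show (0 : ℝ) ≤ 18 * k * B.card from mul_nonneg (by linarith) hn0)
    linarith
  have hF : u ^ 3 * 26 ≤ u ^ 4 := by
    have : u ^ 4 = u ^ 3 * u := by ring
    rw [this]; exact mul_le_mul_of_nonneg_left hu26 (by positivity)
  have hG : u ^ 2 * 26 ≤ u ^ 3 := by
    have : u ^ 3 = u ^ 2 * u := by ring
    rw [this]; exact mul_le_mul_of_nonneg_left hu26 (by positivity)
  have hH : u * 26 ≤ u ^ 2 := by nlinarith
  rw [hu4]
  nlinarith
end
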